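/- arXiv:2310.13920 — 2 statements merged into one kernel-verified Lean document; each statement's English description precedes it below -/
import Mathlib

section
/- For every nondegenerate triangle K in ℝ², the following 18 degrees of freedom are unisolvent on Σʳ(K): the matrix values τ(v_i) at the three vertices, the moments ∫_{e_i} (n_iᵀ τ n_i) q ds for q ∈ ℙ₁(e_i) on each edge, and the means ∫_{e_i} t_iᵀ τ n_i ds on each edge. In particular, if τ ∈ Σʳ(K) and all of these functionals vanish at τ, then τ = 0. -/
open MeasureTheory Matrix

noncomputable section

/-- Points of the plane ℝ². -/
abbrev V2 := Fin 2 → ℝ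

/-- 2×2 real matrices. -/
abbrev Mat2 := Matrix (Fin 2) (Fin 2) ℝ

/-- The Euclidean dot product on ℝ². -/
def dot2 (x y : V2) : ℝ := x 0 * y 0 + x 1 * y 1

/-- The Euclidean norm on ℝ². -/
def norm2 (x : V2) : ℝ := Real.sqrt (dot2 x x)

/-- Rotation by -90 degrees, used to produce a unit normal from a unit tangent. -/
def rot (x : V2) : V2 := ![x 1, -(x 0)]

/-- The closed triangle with vertices `v 0, v 1, v 2`. -/
def tri (v : Fin 3 → V2) : Set V2 := convexHull ℝ (Set.range v)

/-- `f` is (the function of) a real polynomial in two variables of total degree at most `k`. -/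
def PolyDeg (k : ℕ) (f : V2 → ℝ) : Prop :=
  ∃ p : MvPolynomial (Fin 2) ℝ, p.totalDegree ≤ k ∧ ∀ x : V2, f x = MvPolynomial.eval x p

/-- matrix-valued polynomial fields of degree at most `k`, i.e. ℙ_k(·;𝕄). -/
def IsPolyMat (k : ℕ) (τ : V2 → Mat2) : Prop := ∀ i j, PolyDeg k fun x => τ x i j

/-- vector-valued polynomial fields of degree at most `k`, i.e. ℙ_k(·;ℝ²). -/
def IsPolyVec (k : ℕ) (f : V2 → V2) : Prop := ∀ i, PolyDeg k fun x => f x i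

/-- `f` agrees on `[0,1]` with a univariate polynomial of degree at most `k`
(used for restrictions to an edge, in an affine parametrization of the edge). -/
def IsPoly1 (k : ℕ) (f : ℝ → ℝ) : Prop :=
  ∃ p : Polynomial ℝ, p.natDegree ≤ k ∧ ∀ s ∈ Set.Icc (0:ℝ) 1, f s = Polynomial.eval s p

/-- Partial derivative in the `a`-th coordinate direction. -/
def pd (f : V2 → ℝ) (a : Fin 2) : V2 → ℝ := fun x => fderiv ℝ f x (Pi.single a 1)

/-- Directional derivative of `f` in direction `w`. -/
def dirD (f : V2 → ℝ) (w : V2) (x : V2) : ℝ := fderiv ℝ f x w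

/-- Row-wise divergence of a matrix-valued field. -/
def divMat (τ : V2 → Mat2) : V2 → V2 := fun x i => ∑ j, pd (fun y => τ y i j) j x

/-- The edge `e i` of the triangle, opposite to the vertex `v i`. -/
def edgeSet (v : Fin 3 → V2) (i : Fin 3) : Set V2 := segment ℝ (v (i+1)) (v (i+2))

/-- Affine parametrization of the edge `e i` over `[0,1]`. -/
def edgePt (v : Fin 3 → V2) (i : Fin 3) (s : ℝ) : V2 := v (i+1) + s • (v (i+2) - v (i+1))

/-- The length of the edge `e i`. -/
def elen (v : Fin 3 → V2) (i : Fin 3) : ℝ := norm2 (v (i+2) - v (i+1))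

/-- The unit tangent vector of the edge `e i`. -/
def tang (v : Fin 3 → V2) (i : Fin 3) : V2 := (elen v i)⁻¹ • (v (i+2) - v (i+1))

/-- The unit normal vector of the edge `e i`. -/
def nrml (v : Fin 3 → V2) (i : Fin 3) : V2 := rot (tang v i)

/-- The arclength integral over the edge `e i`. -/
def edgeInt (v : Fin 3 → V2) (i : Fin 3) (f : V2 → ℝ) : ℝ :=
  ∫ s in (0:ℝ)..1, f (edgePt v i s) * elen v i

/-- The symmetric part of a matrix. -/
def symm2 (A : Mat2) : Mat2 := (2:ℝ)⁻¹ • (A + Aᵀ)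

/-- The shape function space Σ(K) = {τ ∈ ℙ₃(K;𝕊) : div τ ∈ ℙ₁(K;ℝ²),
tᵀτn|ₑ ∈ ℙ₂(e) for each edge e}. -/
def SigmaSet (v : Fin 3 → V2) : Set (V2 → Mat2) :=
  {τ | IsPolyMat 3 τ ∧ (∀ x, (τ x).IsSymm) ∧ IsPolyVec 1 (divMat τ) ∧
    ∀ i : Fin 3, IsPoly1 2 fun s => dot2 (tang v i) ((τ (edgePt v i s)).mulVec (nrml v i))}

/-- The space RM of rigid motions in two dimensions: x ↦ a + b (x₂, −x₁)ᵀ. -/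
def RM2 : Set (V2 → V2) := {u | ∃ a : V2, ∃ b : ℝ, ∀ x, u x = a + b • ![x 1, -(x 0)]}

/-- The reduced shape function space Σʳ(K) = {τ ∈ ℙ₃(K;𝕊) : div τ ∈ RM,
tᵀτn restricted to each edge has degree at most 2}. -/
def SigmaR (v : Fin 3 → V2) : Set (V2 → Mat2) :=
  {τ | IsPolyMat 3 τ ∧ (∀ x, (τ x).IsSymm) ∧ divMat τ ∈ RM2 ∧
    ∀ i : Fin 3, IsPoly1 2 fun s => dot2 (tang v i) ((τ (edgePt v i s)).mulVec (nrml v i))}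

/-- Normal-normal edge moment DoF: ∫_{e_i} (nᵀ τ n) q ds (arclength), with the
weight q ∈ ℙ₁(e_i) given in the affine parametrization of the edge. -/
def dofNN (v : Fin 3 → V2) (i : Fin 3) (τ : V2 → Mat2) (P : Polynomial ℝ) : ℝ :=
  ∫ s in (0:ℝ)..1,
    dot2 (nrml v i) ((τ (edgePt v i s)).mulVec (nrml v i)) * Polynomial.eval s P * elen v i

/-- Tangent-normal edge mean DoF: ∫_{e_i} tᵀ τ n ds (arclength). -/
def dofTN (v : Fin 3 → V2) (i : Fin 3) (τ : V2 → Mat2) : ℝ :=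
  ∫ s in (0:ℝ)..1, dot2 (tang v i) ((τ (edgePt v i s)).mulVec (nrml v i)) * elen v i

/-- Interior moment DoF: ∫_K τ : q dx, Frobenius inner product against a constant matrix. -/
def dofInt (v : Fin 3 → V2) (τ : V2 → Mat2) (q : Mat2) : ℝ :=
  ∫ x in tri v, ∑ i, ∑ j, τ x i j * q i j

/-! ### Edge vectors and barycentric coordinates -/

/-- The planar cross product. -/
def cross2 (x y : V2) : ℝ := x 0 * y 1 - x 1 * y 0

/-- The unnormalised tangent vector of the edge opposite to the vertex `v i`. -/
def edgeVec (v : Fin 3 → V2) (i : Fin 3) : V2 := v (i + 2) - v (i + 1)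

/-- Twice the signed area of the triangle. -/
def area2 (v : Fin 3 → V2) : ℝ := cross2 (v 1 - v 0) (v 2 - v 0)

/-- The barycentric coordinates of a point. -/
def bary (v : Fin 3 → V2) (x : V2) (i : Fin 3) : ℝ :=
  cross2 (edgeVec v i) (x - v (i + 1)) / area2 v

/-- The barycentric coordinates of a direction. -/
def baryDir (v : Fin 3 → V2) (u : V2) (i : Fin 3) : ℝ :=
  cross2 (edgeVec v i) u / area2 v

theorem forall_fin_three {P : Fin 3 → Prop} (h0 : P 0) (h1 : P 1) (h2 : P 2) : ∀ i, P i
  | 0 => h0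
  | 1 => h1
  | 2 => h2

theorem area2_ne_zero {v : Fin 3 → V2} (hv : AffineIndependent ℝ v) : area2 v ≠ 0 := by
  intro h
  have h0 := (affineIndependent_iff_of_fintype ℝ v).1 hv
  have key : ∀ w : Fin 3 → ℝ, w 0 + w 1 + w 2 = 0 →
      (∀ j, w 0 * v 0 j + w 1 * v 1 j + w 2 * v 2 j = 0) → ∀ i, w i = 0 := by
    intro w hw hw'
    have hs : ∑ i, w i = 0 := by simpa [Fin.sum_univ_three] using hw
    refine h0 w hs ?_
    rw [Finset.weightedVSub_eq_linear_combination _ hs]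
    ext j
    simpa [Fin.sum_univ_three] using hw' j
  simp only [area2, cross2, Pi.sub_apply] at h
  have hA : ∀ j, v 1 j = v 0 j := by
    intro j
    have := key ![v 1 j - v 2 j, v 2 j - v 0 j, v 0 j - v 1 j] (by simp) (by
      intro j'
      fin_cases j <;> fin_cases j' <;> simp <;> linarith) 2
    simp at this
    linarith
  have := key ![-1, 1, 0] (by simp) (by intro j; simp [hA j]) 1
  simp at this

theorem bary_sum {v : Fin 3 → V2} (hD : area2 v ≠ 0) (x : V2) :
    bary v x 0 + bary v x 1 + bary v x 2 = 1 := by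
  simp only [bary, ← add_div, div_eq_one_iff_eq hD]
  simp [area2, cross2, edgeVec]
  ring

theorem bary_combination {v : Fin 3 → V2} (hD : area2 v ≠ 0) (x : V2) (j : Fin 2) :
    bary v x 0 * v 0 j + bary v x 1 * v 1 j + bary v x 2 * v 2 j = x j := by
  simp only [bary]
  field_simp
  fin_cases j <;> simp [area2, cross2, edgeVec] <;> ring

theorem bary_line (v : Fin 3 → V2) (x u : V2) (r : ℝ) (i : Fin 3) :
    bary v (x + r • u) i = bary v x i + r * baryDir v u i := by
  simp [bary, baryDir, cross2]
  ring

theorem baryDir_edgeVec {v : Fin 3 → V2} (hD : area2 v ≠ 0) (i : Fin 3) :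
    baryDir v (edgeVec v i) i = 0 ∧ baryDir v (edgeVec v i) (i + 1) = -1 ∧
      baryDir v (edgeVec v i) (i + 2) = 1 := by
  simp only [baryDir, div_eq_iff hD]
  revert i
  refine forall_fin_three ?_ ?_ ?_ <;> refine ⟨?_, ?_, ?_⟩ <;>
    simp [area2, cross2, edgeVec] <;> ring

theorem bary_vertex {v : Fin 3 → V2} (hD : area2 v ≠ 0) (i : Fin 3) :
    bary v (v i) i = 1 ∧ bary v (v i) (i + 1) = 0 ∧ bary v (v i) (i + 2) = 0 := by
  simp only [bary, div_eq_iff hD]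
  revert i
  refine forall_fin_three ?_ ?_ ?_ <;> refine ⟨?_, ?_, ?_⟩ <;>
    simp [area2, cross2, edgeVec] <;> ring

theorem bary_edgePt {v : Fin 3 → V2} (hD : area2 v ≠ 0) (i : Fin 3) (r : ℝ) :
    bary v (edgePt v i r) i = 0 ∧ bary v (edgePt v i r) (i + 1) = 1 - r ∧
      bary v (edgePt v i r) (i + 2) = r := by
  simp only [bary, div_eq_iff hD]
  revert i
  refine forall_fin_three ?_ ?_ ?_ <;> simp [area2, cross2, edgeVec, edgePt] <;>
    refine ⟨?_, ?_, ?_⟩ <;> ring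

/-! ### Cubic forms in barycentric coordinates -/

/-- Coefficients of a ternary cubic form: the cubes `l i ^ 3`, the edge monomials
`l (i + 1) ^ 2 * l (i + 2)` and `l (i + 1) * l (i + 2) ^ 2`, and `l 0 * l 1 * l 2`. -/
abbrev CubCoeff := (Fin 3 → ℝ) × (Fin 3 → ℝ) × (Fin 3 → ℝ) × ℝ

/-- The ternary cubic form with given coefficients. -/
def cubic (k : CubCoeff) (l : Fin 3 → ℝ) : ℝ :=
  (∑ i, (k.1 i * l i ^ 3 + k.2.1 i * l (i + 1) ^ 2 * l (i + 2)
    + k.2.2.1 i * l (i + 1) * l (i + 2) ^ 2)) + k.2.2.2 * (l 0 * l 1 * l 2)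

/-- The derivative of `cubic k` at `l` in the direction `d`. -/
def cubicDeriv (k : CubCoeff) (d l : Fin 3 → ℝ) : ℝ :=
  (∑ i, (k.1 i * (3 * l i ^ 2 * d i)
    + k.2.1 i * (2 * l (i + 1) * d (i + 1) * l (i + 2) + l (i + 1) ^ 2 * d (i + 2))
    + k.2.2.1 i * (d (i + 1) * l (i + 2) ^ 2 + l (i + 1) * (2 * l (i + 2) * d (i + 2)))))
    + k.2.2.2 * (d 0 * l 1 * l 2 + l 0 * d 1 * l 2 + l 0 * l 1 * d 2)

theorem cubic_add (k k' : CubCoeff) (l : Fin 3 → ℝ) :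
    cubic (k + k') l = cubic k l + cubic k' l := by
  simp [cubic, Fin.sum_univ_three]; ring

theorem cubic_smul (c : ℝ) (k : CubCoeff) (l : Fin 3 → ℝ) :
    cubic (c • k) l = c * cubic k l := by
  simp [cubic, Fin.sum_univ_three]; ring

theorem cubicDeriv_add (k k' : CubCoeff) (d l : Fin 3 → ℝ) :
    cubicDeriv (k + k') d l = cubicDeriv k d l + cubicDeriv k' d l := by
  simp [cubicDeriv, Fin.sum_univ_three]; ring

theorem cubicDeriv_smul (c : ℝ) (k : CubCoeff) (d l : Fin 3 → ℝ) :
    cubicDeriv (c • k) d l = c * cubicDeriv k d l := by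
  simp [cubicDeriv, Fin.sum_univ_three]; ring

theorem exists_cubic_eq_mul (a b c : Fin 3 → ℝ) : ∃ k : CubCoeff, ∀ l : Fin 3 → ℝ,
    cubic k l = (l 0 * a 0 + l 1 * a 1 + l 2 * a 2) * (l 0 * b 0 + l 1 * b 1 + l 2 * b 2)
      * (l 0 * c 0 + l 1 * c 1 + l 2 * c 2) := by
  refine ⟨(fun i => a i * b i * c i,
    fun i => a (i + 1) * b (i + 1) * c (i + 2) + a (i + 1) * b (i + 2) * c (i + 1)
      + a (i + 2) * b (i + 1) * c (i + 1),
    fun i => a (i + 2) * b (i + 2) * c (i + 1) + a (i + 2) * b (i + 1) * c (i + 2)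
      + a (i + 1) * b (i + 2) * c (i + 2),
    a 0 * b 1 * c 2 + a 0 * b 2 * c 1 + a 1 * b 0 * c 2 + a 1 * b 2 * c 0 + a 2 * b 0 * c 1
      + a 2 * b 1 * c 0), fun l => ?_⟩
  simp [cubic, Fin.sum_univ_three]; ring

theorem exists_cubic_monomial {v : Fin 3 → V2} (hD : area2 v ≠ 0) {m n : ℕ} (h : m + n ≤ 3) :
    ∃ k : CubCoeff, ∀ x : V2, x 0 ^ m * x 1 ^ n = cubic k (bary v x) := by
  have h1 : ∀ x, bary v x 0 * 1 + bary v x 1 * 1 + bary v x 2 * 1 = 1 := fun x => by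
    simpa using bary_sum hD x
  let e : Option (Fin 2) → Fin 3 → ℝ := fun o i => o.elim 1 (v i)
  have he : ∀ (x : V2) (o : Option (Fin 2)),
      bary v x 0 * e o 0 + bary v x 1 * e o 1 + bary v x 2 * e o 2 = o.elim 1 x := by
    rintro x (_ | j)
    · exact h1 x
    · exact bary_combination hD x j
  have main : ∀ o₁ o₂ o₃ : Option (Fin 2), ∃ k : CubCoeff, ∀ x : V2,
      o₁.elim 1 x * o₂.elim 1 x * o₃.elim 1 x = cubic k (bary v x) := by
    intro o₁ o₂ o₃
    obtain ⟨k, hk⟩ := exists_cubic_eq_mul (e o₁) (e o₂) (e o₃)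
    exact ⟨k, fun x => by rw [hk, he, he, he]⟩
  have hm : m ≤ 3 := by omega
  have hn : n ≤ 3 := by omega
  interval_cases m <;> interval_cases n <;> first
    | omega
    | simpa using main none none none
    | simpa using main (some 0) none none
    | simpa using main (some 1) none none
    | simpa [pow_succ] using main (some 0) (some 0) none
    | simpa [pow_succ] using main (some 0) (some 1) none
    | simpa [pow_succ] using main (some 1) (some 1) none
    | simpa [pow_succ] using main (some 0) (some 0) (some 0)
    | simpa [pow_succ] using main (some 0) (some 0) (some 1)
    | simpa [pow_succ, mul_assoc] using main (some 0) (some 1) (some 1)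
    | simpa [pow_succ] using main (some 1) (some 1) (some 1)

theorem PolyDeg.exists_cubic {v : Fin 3 → V2} (hD : area2 v ≠ 0) {f : V2 → ℝ}
    (hf : PolyDeg 3 f) : ∃ k : CubCoeff, ∀ x, f x = cubic k (bary v x) := by
  obtain ⟨p, hp, hfp⟩ := hf
  have hdeg : ∀ d ∈ p.support, d 0 + d 1 ≤ 3 := fun d hd => by
    have := (MvPolynomial.le_totalDegree hd).trans hp
    rwa [Finsupp.sum_fintype _ _ (fun _ => rfl), Fin.sum_univ_two] at this
  have hsum : ∀ s : Finset (Fin 2 →₀ ℕ), (∀ d ∈ s, d 0 + d 1 ≤ 3) → ∃ k : CubCoeff,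
      ∀ x : V2, ∑ d ∈ s, p.coeff d * (x 0 ^ d 0 * x 1 ^ d 1) = cubic k (bary v x) := by
    intro s
    induction s using Finset.induction_on with
    | empty => exact fun _ => ⟨0, fun x => by simp [cubic]⟩
    | insert d s hds ih =>
      intro h
      obtain ⟨k, hk⟩ := ih fun d' hd' => h d' (Finset.mem_insert_of_mem hd')
      obtain ⟨k', hk'⟩ := exists_cubic_monomial hD (h d (Finset.mem_insert_self d s))
      exact ⟨p.coeff d • k' + k, fun x => by
        rw [Finset.sum_insert hds, hk, hk', cubic_add, cubic_smul]⟩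
  obtain ⟨k, hk⟩ := hsum p.support hdeg
  refine ⟨k, fun x => ?_⟩
  rw [hfp, ← hk, MvPolynomial.eval_eq']
  simp [Fin.prod_univ_two]

theorem PolyDeg.add {n : ℕ} {f g : V2 → ℝ} (hf : PolyDeg n f) (hg : PolyDeg n g) :
    PolyDeg n fun x => f x + g x := by
  obtain ⟨p, hp, hfp⟩ := hf
  obtain ⟨q, hq, hgq⟩ := hg
  exact ⟨p + q, (MvPolynomial.totalDegree_add p q).trans (max_le hp hq), fun x => by
    simp [hfp, hgq]⟩

theorem PolyDeg.mul {m n : ℕ} {f g : V2 → ℝ} (hf : PolyDeg m f) (hg : PolyDeg n g) :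
    PolyDeg (m + n) fun x => f x * g x := by
  obtain ⟨p, hp, hfp⟩ := hf
  obtain ⟨q, hq, hgq⟩ := hg
  exact ⟨p * q, (MvPolynomial.totalDegree_mul p q).trans (add_le_add hp hq), fun x => by
    simp [hfp, hgq]⟩

theorem PolyDeg.const (n : ℕ) (c : ℝ) : PolyDeg n fun _ => c :=
  ⟨MvPolynomial.C c, by simp, fun x => by simp⟩

theorem PolyDeg.coord (j : Fin 2) : PolyDeg 1 fun x => x j :=
  ⟨MvPolynomial.X j, by simp, fun x => by simp⟩

theorem PolyDeg.const_mul {n : ℕ} {f : V2 → ℝ} (c : ℝ) (hf : PolyDeg n f) :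
    PolyDeg n fun x => c * f x := by
  simpa using (PolyDeg.const 0 c).mul hf

theorem PolyDeg.sum {ι : Type*} {n : ℕ} (s : Finset ι) {f : ι → V2 → ℝ}
    (hf : ∀ i, PolyDeg n (f i)) : PolyDeg n fun x => ∑ i ∈ s, f i x := by
  classical
  induction s using Finset.induction_on with
  | empty => simpa using PolyDeg.const n 0
  | insert i s his ih => simpa [Finset.sum_insert his] using (hf i).add ih

theorem polyDeg_bary (v : Fin 3 → V2) (i : Fin 3) : PolyDeg 1 fun x => bary v x i := by
  have h := ((PolyDeg.const 1 (bary v 0 i)).add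
    ((PolyDeg.coord 0).const_mul (baryDir v ![1, 0] i))).add
    ((PolyDeg.coord 1).const_mul (baryDir v ![0, 1] i))
  convert h using 2 with x
  simp [bary, baryDir, cross2]
  ring

theorem polyDeg_cubic (v : Fin 3 → V2) (k : CubCoeff) :
    PolyDeg 3 fun x => cubic k (bary v x) := by
  have hp : ∀ i j m, PolyDeg 3 fun x => bary v x i * bary v x j * bary v x m := fun i j m =>
    ((polyDeg_bary v i).mul (polyDeg_bary v j)).mul (polyDeg_bary v m)
  refine PolyDeg.add (PolyDeg.sum _ fun i => ((?_ : PolyDeg 3 _).add ?_).add ?_)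
    ((hp _ _ _).const_mul _)
  · simpa [pow_succ] using (hp i i i).const_mul (k.1 i)
  · simpa [pow_succ, mul_assoc] using (hp (i + 1) (i + 1) (i + 2)).const_mul (k.2.1 i)
  · simpa [pow_succ, mul_assoc] using (hp (i + 1) (i + 2) (i + 2)).const_mul (k.2.2.1 i)

theorem hasDerivAt_cubic_line (k : CubCoeff) (l d : Fin 3 → ℝ) :
    HasDerivAt (fun r : ℝ => cubic k fun i => l i + r * d i) (cubicDeriv k d l) 0 := by
  have hl : ∀ i, HasDerivAt (fun r : ℝ => l i + r * d i) (d i) 0 := fun i => by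
    simpa using ((hasDerivAt_id (0 : ℝ)).mul_const (d i)).const_add (l i)
  have := (HasDerivAt.fun_sum (u := Finset.univ) fun i _ =>
    ((((hl i).pow 3).const_mul (k.1 i)).add
    ((((hl (i + 1)).pow 2).const_mul (k.2.1 i)).mul (hl (i + 2)))).add
    (((hl (i + 1)).const_mul (k.2.2.1 i)).mul ((hl (i + 2)).pow 2))).add
    ((((hl 0).mul (hl 1)).mul (hl 2)).const_mul k.2.2.2)
  refine this.congr_deriv ?_
  simp [cubicDeriv, Fin.sum_univ_three]
  ring

theorem differentiable_cubic_bary (v : Fin 3 → V2) (k : CubCoeff) :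
    Differentiable ℝ fun x => cubic k (bary v x) := by
  unfold cubic bary cross2
  fun_prop

theorem fderiv_cubic_bary (v : Fin 3 → V2) (k : CubCoeff) (x u : V2) :
    fderiv ℝ (fun y => cubic k (bary v y)) x u = cubicDeriv k (baryDir v u) (bary v x) := by
  rw [← (differentiable_cubic_bary v k x).lineDeriv_eq_fderiv, lineDeriv]
  have h : ∀ r : ℝ, bary v (x + r • u) = fun i => bary v x i + r * baryDir v u i := fun r =>
    funext (bary_line v x u r)
  simp only [h]
  exact (hasDerivAt_cubic_line k _ _).deriv

/-! ### Symmetric cubic matrix fields in the basis of edge dyads -/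

/-- The symmetric matrix field with barycentric cubic coefficients along the edge dyads. -/
def dyadField (v : Fin 3 → V2) (κ : Fin 3 → CubCoeff) (x : V2) : Mat2 :=
  ∑ m, cubic (κ m) (bary v x) • vecMulVec (edgeVec v m) (edgeVec v m)

theorem dyadField_apply (v : Fin 3 → V2) (κ : Fin 3 → CubCoeff) (x : V2) (i j : Fin 2) :
    dyadField v κ x i j = ∑ m, cubic (κ m) (bary v x) * (edgeVec v m i * edgeVec v m j) := by
  simp [dyadField, Matrix.sum_apply, vecMulVec_apply]

/-- The coefficient of a symmetric matrix along the dyad of the edge vector `m`. -/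
def dyadCoeff (v : Fin 3 → V2) (m : Fin 3) (A : Mat2) : ℝ :=
  -dot2 (rot (edgeVec v (m + 1))) (A.mulVec (rot (edgeVec v (m + 2)))) / area2 v ^ 2

theorem eq_sum_dyadCoeff {v : Fin 3 → V2} (hD : area2 v ≠ 0) {A : Mat2} (hA : A.IsSymm)
    (i j : Fin 2) : A i j = ∑ m, dyadCoeff v m A * (edgeVec v m i * edgeVec v m j) := by
  have h : A 1 0 = A 0 1 := hA.apply 0 1
  simp only [dyadCoeff, Fin.sum_univ_three]
  field_simp
  fin_cases i <;> fin_cases j <;>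
    simp [area2, cross2, edgeVec, dot2, rot, mulVec, dotProduct, h] <;> ring

theorem dyadCoeff_sum {v : Fin 3 → V2} (hD : area2 v ≠ 0) (c : Fin 3 → ℝ) (m : Fin 3) :
    dyadCoeff v m (∑ p, c p • vecMulVec (edgeVec v p) (edgeVec v p)) = c m := by
  rw [dyadCoeff, div_eq_iff (pow_ne_zero 2 hD)]
  revert m
  refine forall_fin_three ?_ ?_ ?_ <;>
    simp [area2, cross2, edgeVec, dot2, rot, mulVec, dotProduct, Fin.sum_univ_three,
      vecMulVec_apply] <;> ring

theorem dyadField_symm (v : Fin 3 → V2) (κ : Fin 3 → CubCoeff) (x : V2) :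
    (dyadField v κ x).IsSymm := by
  ext i j
  simp [dyadField_apply, mul_comm]

theorem isPolyMat_dyadField (v : Fin 3 → V2) (κ : Fin 3 → CubCoeff) :
    IsPolyMat 3 (dyadField v κ) := fun i j => by
  simp only [dyadField_apply, mul_comm (cubic _ _)]
  exact PolyDeg.sum _ fun m => (polyDeg_cubic v (κ m)).const_mul _

theorem exists_dyadField_eq {v : Fin 3 → V2} (hD : area2 v ≠ 0) {τ : V2 → Mat2}
    (hτ : IsPolyMat 3 τ) (hs : ∀ x, (τ x).IsSymm) : ∃ κ, τ = dyadField v κ := by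
  choose k hk using fun i j => (hτ i j).exists_cubic hD
  have hc : ∀ m, ∃ κ : CubCoeff, ∀ x, dyadCoeff v m (τ x) = cubic κ (bary v x) := by
    intro m
    set a := rot (edgeVec v (m + 1)) with ha
    set b := rot (edgeVec v (m + 2)) with hb
    refine ⟨(-(a 0 * b 0) / area2 v ^ 2) • k 0 0 + (-(a 0 * b 1) / area2 v ^ 2) • k 0 1
      + (-(a 1 * b 0) / area2 v ^ 2) • k 1 0 + (-(a 1 * b 1) / area2 v ^ 2) • k 1 1, fun x => ?_⟩
    simp only [cubic_add, cubic_smul, ← hk, dyadCoeff, ← ha, ← hb]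
    simp [dot2, mulVec, dotProduct]
    ring
  choose κ hκ using hc
  refine ⟨κ, funext fun x => ?_⟩
  ext i j
  rw [dyadField_apply, eq_sum_dyadCoeff hD (hs x)]
  simp only [hκ]

/-! ### The divergence constraint -/

/-- The barycentric direction of the edge vector `m`. -/
def edgeDir (m i : Fin 3) : ℝ := if i = m then 0 else if i = m + 1 then -1 else 1

/-- The barycentric coordinates of the midpoint of the edge `p`. -/
def midBary (p i : Fin 3) : ℝ := if i = p then 0 else 1 / 2

/-- The component along the edge vector `m` of the divergence of a dyadic field, as a function of
the barycentric coordinates. -/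
def divComp (κ : Fin 3 → CubCoeff) (m : Fin 3) (l : Fin 3 → ℝ) : ℝ :=
  cubicDeriv (κ m) (edgeDir m) l

/-- The value of `divComp` at a vertex. -/
def divVertex (κ : Fin 3 → CubCoeff) (m i : Fin 3) : ℝ := divComp κ m (Pi.single i 1)

/-- The deviation of `divComp` from being affine along the edge `p`. -/
def divDefect (κ : Fin 3 → CubCoeff) (m p : Fin 3) : ℝ :=
  4 * divComp κ m (midBary p) - 2 * (divVertex κ m (p + 1) + divVertex κ m (p + 2))

/-- The symmetric gradient of the vertex interpolant of the divergence, tested with the edge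
vector `i`. -/
def divStrain (v : Fin 3 → V2) (κ : Fin 3 → CubCoeff) (i : Fin 3) : ℝ :=
  ∑ m, (divVertex κ m (i + 2) - divVertex κ m (i + 1)) * dot2 (edgeVec v m) (edgeVec v i)

theorem baryDir_edgeVec_eq {v : Fin 3 → V2} (hD : area2 v ≠ 0) (m : Fin 3) :
    baryDir v (edgeVec v m) = edgeDir m := by
  obtain ⟨h0, h1, h2⟩ := baryDir_edgeVec hD m
  funext i
  revert i h0 h1 h2
  revert m
  refine forall_fin_three ?_ ?_ ?_ <;> intro h0 h1 h2 <;>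
    refine forall_fin_three ?_ ?_ ?_ <;> simp_all [edgeDir]

theorem bary_vertex_eq {v : Fin 3 → V2} (hD : area2 v ≠ 0) (i : Fin 3) :
    bary v (v i) = Pi.single i 1 := by
  obtain ⟨h0, h1, h2⟩ := bary_vertex hD i
  funext j
  revert j h0 h1 h2
  revert i
  refine forall_fin_three ?_ ?_ ?_ <;> intro h0 h1 h2 <;>
    refine forall_fin_three ?_ ?_ ?_ <;> simp_all

theorem bary_midpoint_eq {v : Fin 3 → V2} (hD : area2 v ≠ 0) (i : Fin 3) :
    bary v (edgePt v i (1 / 2)) = midBary i := by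
  obtain ⟨h0, h1, h2⟩ := bary_edgePt hD i (1 / 2)
  funext j
  revert j h0 h1 h2
  revert i
  refine forall_fin_three ?_ ?_ ?_ <;> intro h0 h1 h2 <;>
    refine forall_fin_three ?_ ?_ ?_ <;> norm_num [midBary] <;> norm_num at * <;> assumption

theorem divMat_dyadField {v : Fin 3 → V2} (hD : area2 v ≠ 0) (κ : Fin 3 → CubCoeff) (x : V2)
    (i : Fin 2) :
    divMat (dyadField v κ) x i = ∑ m, divComp κ m (bary v x) * edgeVec v m i := by
  have hpd : ∀ j, pd (fun y => dyadField v κ y i j) j x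
      = ∑ m, fderiv ℝ (fun y => cubic (κ m) (bary v y)) x (Pi.single j 1)
        * (edgeVec v m i * edgeVec v m j) := by
    intro j
    simp only [pd, dyadField_apply]
    rw [fderiv_fun_sum fun m _ => (differentiable_cubic_bary v (κ m) x).mul_const _]
    simp only [fderiv_mul_const (differentiable_cubic_bary v _ x)]
    simp [mul_comm]
  simp only [divMat, hpd]
  rw [Finset.sum_comm]
  refine Finset.sum_congr rfl fun m _ => ?_
  rw [divComp, ← baryDir_edgeVec_eq hD, ← fderiv_cubic_bary]
  have hw : edgeVec v m = edgeVec v m 0 • Pi.single (0 : Fin 2) (1 : ℝ)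
      + edgeVec v m 1 • Pi.single (1 : Fin 2) (1 : ℝ) := by
    ext j; fin_cases j <;> simp
  conv_rhs => rw [hw]
  simp only [map_add, map_smul, Fin.sum_univ_two, Pi.add_apply, Pi.smul_apply, smul_eq_mul]
  fin_cases i <;> simp <;> ring

theorem divComp_eq (κ : Fin 3 → CubCoeff) (m : Fin 3) {l : Fin 3 → ℝ}
    (hl : l 0 + l 1 + l 2 = 1) :
    divComp κ m l = (∑ i, divVertex κ m i * l i)
      + ∑ p, divDefect κ m p * (l (p + 1) * l (p + 2)) := by
  have h0 : l 0 = 1 - l 1 - l 2 := by linarith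
  revert m
  refine forall_fin_three ?_ ?_ ?_ <;>
    simp [divDefect, divVertex, divComp, cubicDeriv, Fin.sum_univ_three, edgeDir, midBary,
      Pi.single_apply, h0] <;> ring

theorem eq_of_sum_edgeVec_eq_zero {v : Fin 3 → V2} (hD : area2 v ≠ 0) {c : Fin 3 → ℝ}
    (h : ∀ j, ∑ m, c m * edgeVec v m j = 0) : c 1 = c 0 ∧ c 2 = c 0 := by
  have h0 := h 0
  have h1 := h 1
  simp [edgeVec, Fin.sum_univ_three] at h0 h1
  refine ⟨sub_eq_zero.1 ((mul_eq_zero_iff_right hD).1 ?_),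
    sub_eq_zero.1 ((mul_eq_zero_iff_right hD).1 ?_)⟩ <;>
    simp only [area2, cross2, Pi.sub_apply]
  · linear_combination (v 1 1 - v 0 1) * h0 - (v 1 0 - v 0 0) * h1
  · linear_combination (v 2 1 - v 0 1) * h0 - (v 2 0 - v 0 0) * h1

theorem mem_RM2_iff {v : Fin 3 → V2} (hD : area2 v ≠ 0) {u : Fin 3 → V2} :
    (∃ a : V2, ∃ b : ℝ, ∀ i, u i = a + b • ![v i 1, -(v i 0)]) ↔
      ∀ i, dot2 (u (i + 2) - u (i + 1)) (edgeVec v i) = 0 := by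
  constructor
  · rintro ⟨a, b, h⟩ i
    simp [h, dot2, edgeVec]
    ring
  · intro h
    have h0 := h 0
    have h1 := h 1
    have h2 := h 2
    simp [dot2, edgeVec] at h0 h1 h2
    set b := -dot2 (u 1 - u 0) (v 2 - v 0) / area2 v with hb
    have hb' : b * area2 v = -dot2 (u 1 - u 0) (v 2 - v 0) := by
      rw [hb, div_mul_cancel₀ _ hD]
    refine ⟨![u 0 0 - b * v 0 1, u 0 1 + b * v 0 0], b, forall_fin_three ?_ ?_ ?_⟩
    · ext j; fin_cases j <;> simp
    all_goals
      ext j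
      refine sub_eq_zero.1 ((mul_eq_zero_iff_right hD).1 ?_)
      fin_cases j <;> simp [-mul_eq_zero, area2, cross2, dot2] at hb' ⊢
    · linear_combination (v 2 1 - v 0 1) * h2 - (v 1 1 - v 0 1) * hb'
    · linear_combination -(v 2 0 - v 0 0) * h2 + (v 1 0 - v 0 0) * hb'
    · linear_combination -(v 1 1 - v 0 1) * h1 + (v 2 1 - v 0 1) * (h1 + h2 - h0)
        - (v 2 1 - v 0 1) * hb'
    · linear_combination (v 1 0 - v 0 0) * h1 - (v 2 0 - v 0 0) * (h1 + h2 - h0)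
        + (v 2 0 - v 0 0) * hb'

theorem sum_edgeVec (v : Fin 3 → V2) (j : Fin 2) :
    edgeVec v 0 j + edgeVec v 1 j + edgeVec v 2 j = 0 := by
  simp [edgeVec]

theorem divMat_dyadField_vertex {v : Fin 3 → V2} (hD : area2 v ≠ 0) (κ : Fin 3 → CubCoeff)
    (i : Fin 3) (j : Fin 2) :
    divMat (dyadField v κ) (v i) j = ∑ m, divVertex κ m i * edgeVec v m j := by
  simp only [divMat_dyadField hD, bary_vertex_eq hD, divVertex]

theorem dot2_divMat_dyadField {v : Fin 3 → V2} (hD : area2 v ≠ 0) (κ : Fin 3 → CubCoeff)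
    (i : Fin 3) :
    dot2 (divMat (dyadField v κ) (v (i + 2)) - divMat (dyadField v κ) (v (i + 1))) (edgeVec v i)
      = divStrain v κ i := by
  simp only [dot2, Pi.sub_apply, divMat_dyadField_vertex hD, divStrain, Fin.sum_univ_three]
  ring

theorem divMat_dyadField_mem_RM2_iff {v : Fin 3 → V2} (hD : area2 v ≠ 0)
    (κ : Fin 3 → CubCoeff) :
    divMat (dyadField v κ) ∈ RM2 ↔
      (∀ p, divDefect κ 1 p = divDefect κ 0 p ∧ divDefect κ 2 p = divDefect κ 0 p) ∧
        ∀ i, divStrain v κ i = 0 := by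
  constructor
  · rintro ⟨a, b, h⟩
    constructor
    · intro p
      refine eq_of_sum_edgeVec_eq_zero hD (c := fun m => divDefect κ m p) fun j => ?_
      have hm := divMat_dyadField hD κ (edgePt v p (1 / 2)) j
      have h1 := divMat_dyadField_vertex hD κ (p + 1) j
      have h2 := divMat_dyadField_vertex hD κ (p + 2) j
      have key : ∑ m, divDefect κ m p * edgeVec v m j
          = 4 * divMat (dyadField v κ) (edgePt v p (1 / 2)) j
            - 2 * (divMat (dyadField v κ) (v (p + 1)) j
              + divMat (dyadField v κ) (v (p + 2)) j) := by
        rw [hm, h1, h2, bary_midpoint_eq hD]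
        simp only [divDefect, Fin.sum_univ_three]
        ring
      rw [key, h, h, h]
      fin_cases j <;> simp [edgePt] <;> ring
    · intro i
      rw [← dot2_divMat_dyadField hD]
      exact (mem_RM2_iff hD (u := fun i => divMat (dyadField v κ) (v i))).1
        ⟨a, b, fun i => h (v i)⟩ i
  · rintro ⟨hd, hs⟩
    obtain ⟨a, b, h⟩ := (mem_RM2_iff hD (u := fun i => divMat (dyadField v κ) (v i))).2
      fun i => (dot2_divMat_dyadField hD κ i).trans (hs i)
    refine ⟨a, b, fun x => ?_⟩
    have hx : ∀ j, divMat (dyadField v κ) x j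
        = ∑ i, bary v x i * divMat (dyadField v κ) (v i) j := by
      intro j
      rw [divMat_dyadField hD]
      simp only [divComp_eq κ _ (bary_sum hD x), divMat_dyadField_vertex hD, Fin.sum_univ_three,
        (hd _).1, (hd _).2]
      linear_combination (divDefect κ 0 0 * (bary v x (0 + 1) * bary v x (0 + 2))
        + divDefect κ 0 1 * (bary v x (1 + 1) * bary v x (1 + 2))
        + divDefect κ 0 2 * (bary v x (2 + 1) * bary v x (2 + 2))) * sum_edgeVec v j
    have h1 := bary_sum hD x
    have hx0 := bary_combination hD x 0
    have hx1 := bary_combination hD x 1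
    ext j
    rw [hx]
    simp only [h, Fin.sum_univ_three]
    fin_cases j <;> simp
    · linear_combination a 0 * h1 + b * hx1
    · linear_combination a 1 * h1 - b * hx0

/-! ### Edge functionals -/

/-- Restriction of a cubic form to the edge `i`, parametrized by `r`. -/
def edgeCubic (k : CubCoeff) (i : Fin 3) (r : ℝ) : ℝ :=
  k.1 (i + 1) * (1 - r) ^ 3 + k.2.1 i * (1 - r) ^ 2 * r + k.2.2.1 i * (1 - r) * r ^ 2
    + k.1 (i + 2) * r ^ 3

/-- The mean of a cubic form over the edge `i`. -/
def edgeMean (k : CubCoeff) (i : Fin 3) : ℝ :=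
  (k.1 (i + 1) + k.1 (i + 2)) / 4 + (k.2.1 i + k.2.2.1 i) / 12

/-- The first moment of a cubic form over the edge `i`. -/
def edgeMoment (k : CubCoeff) (i : Fin 3) : ℝ :=
  k.1 (i + 1) / 20 + k.2.1 i / 30 + k.2.2.1 i / 20 + k.1 (i + 2) / 5

/-- The leading coefficient of the restriction of a cubic form to the edge `i`. -/
def edgeLead (k : CubCoeff) (i : Fin 3) : ℝ :=
  -k.1 (i + 1) + k.2.1 i - k.2.2.1 i + k.1 (i + 2)

/-- The normal-normal component on the edge `i`, up to a scalar factor. -/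
def normalCoeff (κ : Fin 3 → CubCoeff) (i : Fin 3) : CubCoeff := κ (i + 1) + κ (i + 2)

/-- The tangential-normal component on the edge `i`, up to a scalar factor. -/
def tangentCoeff (v : Fin 3 → V2) (κ : Fin 3 → CubCoeff) (i : Fin 3) : CubCoeff :=
  dot2 (edgeVec v i) (edgeVec v (i + 2)) • κ (i + 2)
    + (-dot2 (edgeVec v i) (edgeVec v (i + 1))) • κ (i + 1)

theorem elen_sq (v : Fin 3 → V2) (i : Fin 3) :
    elen v i ^ 2 = dot2 (edgeVec v i) (edgeVec v i) := by
  rw [elen, norm2, Real.sq_sqrt]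
  · rfl
  · simpa only [dot2] using add_nonneg (mul_self_nonneg _) (mul_self_nonneg _)

theorem area2_eq_cross2 (v : Fin 3 → V2) (i : Fin 3) :
    area2 v = cross2 (edgeVec v i) (edgeVec v (i + 1)) := by
  revert i
  refine forall_fin_three ?_ ?_ ?_ <;> simp [area2, cross2, edgeVec] <;> ring

theorem elen_ne_zero {v : Fin 3 → V2} (hD : area2 v ≠ 0) (i : Fin 3) : elen v i ≠ 0 := by
  intro h
  have h2 := elen_sq v i
  rw [h, dot2] at h2
  have h0 : edgeVec v i 0 = 0 := by nlinarith [sq_nonneg (edgeVec v i 0), sq_nonneg (edgeVec v i 1)]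
  have h1 : edgeVec v i 1 = 0 := by nlinarith [sq_nonneg (edgeVec v i 0), sq_nonneg (edgeVec v i 1)]
  exact hD (by rw [area2_eq_cross2 v i, cross2, h0, h1]; ring)

theorem cubic_edge {v : Fin 3 → V2} (hD : area2 v ≠ 0) (k : CubCoeff) (i : Fin 3) (r : ℝ) :
    cubic k (bary v (edgePt v i r)) = edgeCubic k i r := by
  obtain ⟨h0, h1, h2⟩ := bary_edgePt hD i r
  revert h0 h1 h2
  revert i
  refine forall_fin_three ?_ ?_ ?_ <;> intro h0 h1 h2 <;> simp at h0 h1 h2 <;>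
    simp [cubic, edgeCubic, Fin.sum_univ_three, h0, h1, h2] <;> ring

theorem nrml_eq (v : Fin 3 → V2) (i : Fin 3) :
    nrml v i = (elen v i)⁻¹ • rot (edgeVec v i) := by
  ext j
  fin_cases j <;> simp [nrml, rot, tang, edgeVec]
  ring

theorem normal_normal_dyadField {v : Fin 3 → V2} (hD : area2 v ≠ 0) (κ : Fin 3 → CubCoeff)
    (i : Fin 3) (r : ℝ) :
    dot2 (nrml v i) ((dyadField v κ (edgePt v i r)).mulVec (nrml v i))
      = area2 v ^ 2 / elen v i ^ 2 * edgeCubic (normalCoeff κ i) i r := by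
  have hl := elen_ne_zero hD i
  rw [← cubic_edge hD, normalCoeff, cubic_add, nrml_eq]
  generalize edgePt v i r = x
  simp only [dot2, mulVec, dotProduct, Fin.sum_univ_two, dyadField_apply, Pi.smul_apply,
    smul_eq_mul]
  field_simp
  revert i
  refine forall_fin_three ?_ ?_ ?_ <;> intro _ <;>
    simp [area2, cross2, edgeVec, rot, Fin.sum_univ_three] <;> ring

theorem tangent_normal_dyadField {v : Fin 3 → V2} (hD : area2 v ≠ 0) (κ : Fin 3 → CubCoeff)
    (i : Fin 3) (r : ℝ) :
    dot2 (tang v i) ((dyadField v κ (edgePt v i r)).mulVec (nrml v i))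
      = area2 v / elen v i ^ 2 * edgeCubic (tangentCoeff v κ i) i r := by
  have hl := elen_ne_zero hD i
  rw [← cubic_edge hD, tangentCoeff, cubic_add, cubic_smul, cubic_smul, nrml_eq,
    show tang v i = (elen v i)⁻¹ • edgeVec v i from rfl]
  generalize edgePt v i r = x
  simp only [dot2, mulVec, dotProduct, Fin.sum_univ_two, dyadField_apply, Pi.smul_apply,
    smul_eq_mul]
  field_simp
  revert i
  refine forall_fin_three ?_ ?_ ?_ <;> intro _ <;>
    simp [area2, cross2, edgeVec, rot, Fin.sum_univ_three] <;> ring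

theorem integral_quartic (c₀ c₁ c₂ c₃ c₄ : ℝ) :
    ∫ r in (0 : ℝ)..1, (c₀ + c₁ * r + c₂ * r ^ 2 + c₃ * r ^ 3 + c₄ * r ^ 4)
      = c₀ + c₁ / 2 + c₂ / 3 + c₃ / 4 + c₄ / 5 := by
  have h : ∀ r : ℝ, HasDerivAt
      (fun r => c₀ * r + c₁ / 2 * r ^ 2 + c₂ / 3 * r ^ 3 + c₃ / 4 * r ^ 4 + c₄ / 5 * r ^ 5)
      (c₀ + c₁ * r + c₂ * r ^ 2 + c₃ * r ^ 3 + c₄ * r ^ 4) r := by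
    intro r
    have h1 := (hasDerivAt_id' r).const_mul c₀
    have h2 := (hasDerivAt_pow 2 r).const_mul (c₁ / 2)
    have h3 := (hasDerivAt_pow 3 r).const_mul (c₂ / 3)
    have h4 := (hasDerivAt_pow 4 r).const_mul (c₃ / 4)
    have h5 := (hasDerivAt_pow 5 r).const_mul (c₄ / 5)
    refine ((((h1.fun_add h2).fun_add h3).fun_add h4).fun_add h5).congr_deriv ?_
    norm_num
    ring
  rw [intervalIntegral.integral_eq_sub_of_hasDerivAt (fun r _ => h r)
    (Continuous.intervalIntegrable (by fun_prop) _ _)]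
  ring

theorem integral_edgeCubic (k : CubCoeff) (i : Fin 3) :
    ∫ r in (0 : ℝ)..1, edgeCubic k i r = edgeMean k i := by
  have := integral_quartic (k.1 (i + 1)) (-3 * k.1 (i + 1) + k.2.1 i)
    (3 * k.1 (i + 1) - 2 * k.2.1 i + k.2.2.1 i) (edgeLead k i) 0
  rw [edgeLead] at this
  calc _ = _ := by
        refine Eq.trans ?_ this
        congr 1
        funext r
        rw [edgeCubic]
        ring
    _ = _ := by rw [edgeMean]; ring

theorem integral_edgeCubic_mul_id (k : CubCoeff) (i : Fin 3) :
    ∫ r in (0 : ℝ)..1, edgeCubic k i r * r = edgeMoment k i := by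
  have := integral_quartic 0 (k.1 (i + 1)) (-3 * k.1 (i + 1) + k.2.1 i)
    (3 * k.1 (i + 1) - 2 * k.2.1 i + k.2.2.1 i) (edgeLead k i)
  rw [edgeLead] at this
  calc _ = _ := by
        refine Eq.trans ?_ this
        congr 1
        funext r
        rw [edgeCubic]
        ring
    _ = _ := by rw [edgeMoment]; ring

theorem dofNN_one_dyadField {v : Fin 3 → V2} (hD : area2 v ≠ 0) (κ : Fin 3 → CubCoeff)
    (i : Fin 3) :
    dofNN v i (dyadField v κ) 1 = area2 v ^ 2 / elen v i * edgeMean (normalCoeff κ i) i := by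
  have hl := elen_ne_zero hD i
  rw [← integral_edgeCubic, ← intervalIntegral.integral_const_mul, dofNN]
  congr 1
  funext r
  rw [normal_normal_dyadField hD, Polynomial.eval_one]
  field_simp

theorem dofNN_X_dyadField {v : Fin 3 → V2} (hD : area2 v ≠ 0) (κ : Fin 3 → CubCoeff)
    (i : Fin 3) :
    dofNN v i (dyadField v κ) Polynomial.X
      = area2 v ^ 2 / elen v i * edgeMoment (normalCoeff κ i) i := by
  have hl := elen_ne_zero hD i
  rw [← integral_edgeCubic_mul_id, ← intervalIntegral.integral_const_mul, dofNN]
  congr 1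
  funext r
  rw [normal_normal_dyadField hD, Polynomial.eval_X]
  field_simp

theorem dofTN_dyadField {v : Fin 3 → V2} (hD : area2 v ≠ 0) (κ : Fin 3 → CubCoeff)
    (i : Fin 3) :
    dofTN v i (dyadField v κ) = area2 v / elen v i * edgeMean (tangentCoeff v κ i) i := by
  have hl := elen_ne_zero hD i
  rw [← integral_edgeCubic, ← intervalIntegral.integral_const_mul, dofTN]
  congr 1
  funext r
  rw [tangent_normal_dyadField hD]
  field_simp

theorem isPoly1_two_of_eq {f : ℝ → ℝ} {a₂ a₁ a₀ : ℝ}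
    (h : ∀ r, f r = a₂ * r ^ 2 + a₁ * r + a₀) : IsPoly1 2 f :=
  ⟨Polynomial.C a₂ * Polynomial.X ^ 2 + Polynomial.C a₁ * Polynomial.X + Polynomial.C a₀,
    Polynomial.natDegree_quadratic_le, fun r _ => by simp [h]⟩

theorem isPoly1_two_iff {c : ℝ} (hc : c ≠ 0) (k : CubCoeff) (i : Fin 3) :
    IsPoly1 2 (fun r => c * edgeCubic k i r) ↔ edgeLead k i = 0 := by
  constructor
  · rintro ⟨p, hp, h⟩
    have he : ∀ r, p.eval r = p.coeff 0 + p.coeff 1 * r + p.coeff 2 * r ^ 2 := fun r => by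
      rw [Polynomial.eval_eq_sum_range' (Nat.lt_succ_of_le hp)]
      simp [Finset.sum_range_succ]
    have h0 := h 0 (by norm_num)
    have h1 := h (1 / 3) (by norm_num)
    have h2 := h (2 / 3) (by norm_num)
    have h3 := h 1 (by norm_num)
    rw [he] at h0 h1 h2 h3
    simp only [edgeCubic] at h0 h1 h2 h3
    refine (mul_eq_zero_iff_left hc).1 ?_
    rw [edgeLead]
    linear_combination 9 / 2 * (h3 - 3 * h2 + 3 * h1 - h0)
  · intro h
    refine isPoly1_two_of_eq (fun r => ?_) (a₂ := c * (3 * k.1 (i + 1) - 2 * k.2.1 i + k.2.2.1 i))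
      (a₁ := c * (-3 * k.1 (i + 1) + k.2.1 i)) (a₀ := c * k.1 (i + 1))
    rw [edgeLead] at h
    simp only [edgeCubic]
    linear_combination c * r ^ 3 * h

theorem dyadField_mem_SigmaR_iff {v : Fin 3 → V2} (hD : area2 v ≠ 0) (κ : Fin 3 → CubCoeff) :
    dyadField v κ ∈ SigmaR v ↔
      ((∀ p, divDefect κ 1 p = divDefect κ 0 p ∧ divDefect κ 2 p = divDefect κ 0 p) ∧
        ∀ i, divStrain v κ i = 0) ∧ ∀ i, edgeLead (tangentCoeff v κ i) i = 0 := by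
  rw [← divMat_dyadField_mem_RM2_iff hD]
  simp only [SigmaR, Set.mem_ofPred_eq, isPolyMat_dyadField, dyadField_symm, implies_true,
    true_and, tangent_normal_dyadField hD,
    isPoly1_two_iff (div_ne_zero hD (pow_ne_zero 2 (elen_ne_zero hD _)))]

theorem dyadField_vertex_iff {v : Fin 3 → V2} (hD : area2 v ≠ 0) (κ : Fin 3 → CubCoeff)
    {A : Mat2} (hA : A.IsSymm) (i : Fin 3) :
    dyadField v κ (v i) = A ↔ ∀ m, (κ m).1 i = dyadCoeff v m A := by
  have hc : ∀ m, cubic (κ m) (bary v (v i)) = (κ m).1 i := by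
    intro m
    rw [bary_vertex_eq hD]
    revert i
    refine forall_fin_three ?_ ?_ ?_ <;> simp [cubic, Fin.sum_univ_three, Pi.single_apply]
  constructor
  · rintro rfl m
    rw [dyadField, dyadCoeff_sum hD, hc]
  · intro h
    ext a b
    simp only [dyadField_apply, hc, h, eq_sum_dyadCoeff hD hA]

/-! ### The linear system -/

/-- The degrees of freedom and the constraints of `SigmaR v` as a linear map on coefficients. -/
def dofMap (v : Fin 3 → V2) :
    (Fin 3 → CubCoeff) →ₗ[ℝ] (Fin 3 → Fin 3 → ℝ) × (Fin 3 → Fin 7 → ℝ) where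
  toFun κ := (fun m i => (κ m).1 i, fun i =>
    ![area2 v ^ 2 / elen v i * edgeMean (normalCoeff κ i) i,
      area2 v ^ 2 / elen v i * edgeMoment (normalCoeff κ i) i,
      area2 v / elen v i * edgeMean (tangentCoeff v κ i) i,
      edgeLead (tangentCoeff v κ i) i,
      divDefect κ 1 i - divDefect κ 0 i,
      divDefect κ 2 i - divDefect κ 0 i,
      divStrain v κ i])
  map_add' κ κ' := by
    refine Prod.ext rfl (funext fun i => ?_)
    ext n
    fin_cases n <;>
      simp [edgeMean, edgeMoment, edgeLead, normalCoeff, tangentCoeff, divDefect, divVertex,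
        divStrain, divComp, cubicDeriv_add, Fin.sum_univ_three] <;> ring
  map_smul' c κ := by
    refine Prod.ext rfl (funext fun i => ?_)
    ext n
    fin_cases n <;>
      simp [edgeMean, edgeMoment, edgeLead, normalCoeff, tangentCoeff, divDefect, divVertex,
        divStrain, divComp, cubicDeriv_smul, Fin.sum_univ_three] <;> ring

theorem edge_coeff_eq_zero {v : Fin 3 → V2} (hD : area2 v ≠ 0) {κ : Fin 3 → CubCoeff}
    (hκ : dofMap v κ = 0) (i : Fin 3) :
    ((κ (i + 1)).2.1 i = 0 ∧ (κ (i + 2)).2.1 i = 0) ∧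
      (κ (i + 1)).2.2.1 i = 0 ∧ (κ (i + 2)).2.2.1 i = 0 := by
  have hl := elen_ne_zero hD i
  have hV : ∀ m i, (κ m).1 i = 0 := fun m i => congrFun (congrFun (congrArg Prod.fst hκ) m) i
  have hR := congrFun (congrArg Prod.snd hκ) i
  have h0 := congrFun hR 0
  have h1 := congrFun hR 1
  have h2 := congrFun hR 2
  have h3 := congrFun hR 3
  simp [dofMap, edgeMean, edgeMoment, edgeLead, normalCoeff, tangentCoeff, hV, hD, hl]
    at h0 h1 h2 h3
  have hg : elen v i ^ 2 = -dot2 (edgeVec v i) (edgeVec v (i + 2))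
      - dot2 (edgeVec v i) (edgeVec v (i + 1)) := by
    rw [elen_sq]
    revert i
    refine forall_fin_three ?_ ?_ ?_ <;> intros <;> simp [dot2, edgeVec] <;> ring
  have hl2 := pow_ne_zero 2 hl
  have hE : (κ (i + 1)).2.1 i + (κ (i + 2)).2.1 i = 0 := by linarith
  have hF : (κ (i + 1)).2.2.1 i + (κ (i + 2)).2.2.1 i = 0 := by linarith
  have e1 : (κ (i + 1)).2.1 i = 0 := by
    refine (mul_eq_zero_iff_left hl2).1 ?_
    rw [hg]
    linear_combination (h2 + h3) / 2 - dot2 (edgeVec v i) (edgeVec v (i + 2)) * hE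
  have e2 : (κ (i + 1)).2.2.1 i = 0 := by
    refine (mul_eq_zero_iff_left hl2).1 ?_
    rw [hg]
    linear_combination (h2 - h3) / 2 - dot2 (edgeVec v i) (edgeVec v (i + 2)) * hF
  rw [e1, e2] at h0 h1
  refine ⟨⟨e1, ?_⟩, e2, ?_⟩ <;> linarith

/-- Coefficients of the cubic forms
`(E m * l (m + 1) + F m * l (m + 2) + Z m * l m) * l (m + 1) * l (m + 2)`. -/
def bubbleCoeff (E F Z : Fin 3 → ℝ) (m : Fin 3) : CubCoeff :=
  (0, Pi.single m (E m), Pi.single m (F m), Z m)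

theorem divDefect_bubbleCoeff (E F Z : Fin 3 → ℝ) (m : Fin 3) :
    divDefect (bubbleCoeff E F Z) m m = 3 * (F m - E m) ∧
    divDefect (bubbleCoeff E F Z) m (m + 1) = F m - Z m ∧
    divDefect (bubbleCoeff E F Z) m (m + 2) = Z m - E m := by
  revert m
  refine forall_fin_three ?_ ?_ ?_ <;> refine ⟨?_, ?_, ?_⟩ <;>
    simp [divDefect, divVertex, divComp, cubicDeriv, Fin.sum_univ_three, edgeDir, midBary,
      bubbleCoeff, Pi.single_apply] <;> ring

theorem divVertex_bubbleCoeff (E F Z : Fin 3 → ℝ) (m : Fin 3) :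
    divVertex (bubbleCoeff E F Z) m m = 0 ∧
    divVertex (bubbleCoeff E F Z) m (m + 1) = E m ∧
    divVertex (bubbleCoeff E F Z) m (m + 2) = -F m := by
  revert m
  refine forall_fin_three ?_ ?_ ?_ <;> refine ⟨?_, ?_, ?_⟩ <;>
    simp [divVertex, divComp, cubicDeriv, Fin.sum_univ_three, edgeDir,
      bubbleCoeff, Pi.single_apply]

theorem bubbleCoeff_eq_zero {v : Fin 3 → V2} (hD : area2 v ≠ 0) {E F Z : Fin 3 → ℝ}
    (hd : ∀ p, divDefect (bubbleCoeff E F Z) 1 p = divDefect (bubbleCoeff E F Z) 0 p ∧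
      divDefect (bubbleCoeff E F Z) 2 p = divDefect (bubbleCoeff E F Z) 0 p)
    (hs : ∀ i, divStrain v (bubbleCoeff E F Z) i = 0) : bubbleCoeff E F Z = 0 := by
  have hd0 := hd 0
  have hd1 := hd 1
  have hd2 := hd 2
  obtain ⟨a0, a1, a2⟩ := divDefect_bubbleCoeff E F Z 0
  obtain ⟨b1, b2, b0⟩ := divDefect_bubbleCoeff E F Z 1
  obtain ⟨c2, c0, c1⟩ := divDefect_bubbleCoeff E F Z 2
  simp at a0 a1 a2 b0 b1 b2 c0 c1 c2
  rw [a0, b0, c0] at hd0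
  rw [a1, b1, c1] at hd1
  rw [a2, b2, c2] at hd2
  have hF : F = E := funext (forall_fin_three (by linarith) (by linarith) (by linarith))
  have hZ : F = Z := by
    subst hF
    exact funext (forall_fin_three (by linarith) (by linarith) (by linarith))
  subst hF hZ
  obtain ⟨a0, a1, a2⟩ := divVertex_bubbleCoeff F F F 0
  obtain ⟨b1, b2, b0⟩ := divVertex_bubbleCoeff F F F 1
  obtain ⟨c2, c0, c1⟩ := divVertex_bubbleCoeff F F F 2
  simp at a0 a1 a2 b0 b1 b2 c0 c1 c2
  have s0 := hs 0
  have s1 := hs 1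
  have s2 := hs 2
  simp [divStrain, Fin.sum_univ_three, a0, a1, a2, b0, b1, b2, c0, c1, c2, dot2] at s0 s1 s2
  have hsq : ∑ j : Fin 2, ((F 1 * edgeVec v 1 j - F 0 * edgeVec v 0 j) ^ 2
      + (F 2 * edgeVec v 2 j - F 1 * edgeVec v 1 j) ^ 2
      + (F 0 * edgeVec v 0 j - F 2 * edgeVec v 2 j) ^ 2) = 0 := by
    rw [Fin.sum_univ_two]
    linear_combination -F 0 * s0 - F 1 * s1 - F 2 * s2
  have hj : ∀ j, F 1 * edgeVec v 1 j = F 0 * edgeVec v 0 j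
      ∧ F 2 * edgeVec v 2 j = F 0 * edgeVec v 0 j := by
    intro j
    have := (Finset.sum_eq_zero_iff_of_nonneg (fun j _ => by positivity)).1 hsq j
      (Finset.mem_univ j)
    have p0 := sq_nonneg (F 1 * edgeVec v 1 j - F 0 * edgeVec v 0 j)
    have p1 := sq_nonneg (F 2 * edgeVec v 2 j - F 1 * edgeVec v 1 j)
    have p2 := sq_nonneg (F 0 * edgeVec v 0 j - F 2 * edgeVec v 2 j)
    have q0 := pow_eq_zero_iff two_ne_zero |>.1 (le_antisymm (by linarith) p0)
    have q2 := pow_eq_zero_iff two_ne_zero |>.1 (le_antisymm (by linarith) p2)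
    exact ⟨by linarith, by linarith⟩
  have k0 := area2_eq_cross2 v 0
  have k2 := area2_eq_cross2 v 2
  simp [cross2] at k0 k2
  have hF0 : ∀ i, F i = 0 := by
    refine forall_fin_three ?_ ?_ ?_ <;> refine (mul_eq_zero_iff_right hD).1 ?_
    · linear_combination F 0 * k0 - edgeVec v 1 1 * (hj 0).1 + edgeVec v 1 0 * (hj 1).1
    · linear_combination F 1 * k0 + edgeVec v 0 0 * (hj 1).1 - edgeVec v 0 1 * (hj 0).1
    · linear_combination F 2 * k2 + edgeVec v 0 1 * (hj 0).2 - edgeVec v 0 0 * (hj 1).2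
  funext m
  simp [bubbleCoeff, hF0]

theorem dofMap_injective {v : Fin 3 → V2} (hD : area2 v ≠ 0) :
    Function.Injective (dofMap v) := by
  refine (injective_iff_map_eq_zero _).2 fun κ hκ => ?_
  have hV : ∀ m i, (κ m).1 i = 0 := fun m i => congrFun (congrFun (congrArg Prod.fst hκ) m) i
  have hR := fun i n => congrFun (congrFun (congrArg Prod.snd hκ) i) n
  have hE := edge_coeff_eq_zero hD hκ
  have hb : κ = bubbleCoeff (fun m => (κ m).2.1 m) (fun m => (κ m).2.2.1 m)
      (fun m => (κ m).2.2.2) := by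
    have hE0 := hE 0
    have hE1 := hE 1
    have hE2 := hE 2
    simp at hE0 hE1 hE2
    refine funext (forall_fin_three ?_ ?_ ?_) <;>
      refine Prod.ext (funext (hV _)) (Prod.ext ?_ (Prod.ext ?_ rfl)) <;>
      refine funext (forall_fin_three ?_ ?_ ?_) <;>
      simp [bubbleCoeff, hE0, hE1, hE2]
  have h4 := fun i => hR i 4
  have h5 := fun i => hR i 5
  have h6 := fun i => hR i 6
  simp [dofMap, sub_eq_zero] at h4 h5 h6
  rw [hb] at h4 h5 h6 ⊢
  exact bubbleCoeff_eq_zero hD (fun p => ⟨h4 p, h5 p⟩) h6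

theorem dofMap_surjective {v : Fin 3 → V2} (hD : area2 v ≠ 0) :
    Function.Surjective (dofMap v) := by
  refine (LinearMap.injective_iff_surjective_of_finrank_eq_finrank ?_).1 (dofMap_injective hD)
  simp [Module.finrank_pi_fintype, Module.finrank_prod]

theorem dofMap_eq_iff {v : Fin 3 → V2} (hD : area2 v ≠ 0) (κ : Fin 3 → CubCoeff)
    {A : Fin 3 → Mat2} (hA : ∀ i, (A i).IsSymm) (m₀ m₁ t₀ : Fin 3 → ℝ) :
    (dyadField v κ ∈ SigmaR v ∧
      (∀ i, dyadField v κ (v i) = A i) ∧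
      (∀ i, dofNN v i (dyadField v κ) 1 = m₀ i ∧
        dofNN v i (dyadField v κ) Polynomial.X = m₁ i) ∧
      (∀ i, dofTN v i (dyadField v κ) = t₀ i)) ↔
    dofMap v κ = (fun m i => dyadCoeff v m (A i),
      fun i => ![m₀ i, m₁ i, t₀ i, 0, 0, 0, 0]) := by
  have hA' : (∀ i, dyadField v κ (v i) = A i) ↔ ∀ m i, (κ m).1 i = dyadCoeff v m (A i) := by
    rw [forall_comm]
    exact forall_congr' fun i => dyadField_vertex_iff hD κ (hA i) i
  rw [hA', dyadField_mem_SigmaR_iff hD]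
  simp only [dofNN_one_dyadField hD, dofNN_X_dyadField hD, dofTN_dyadField hD, dofMap,
    LinearMap.coe_mk, AddHom.coe_mk, Prod.mk.injEq]
  constructor
  · rintro ⟨⟨⟨hd, hs⟩, hl⟩, hV, hN, hT⟩
    refine ⟨funext fun m => funext (hV m), funext fun i => ?_⟩
    rw [(hN i).1, (hN i).2, hT, hl, (hd i).1, (hd i).2, hs, sub_self]
  · rintro ⟨hV, hR⟩
    have h := fun i => congrFun (congrFun hR i)
    exact ⟨⟨⟨fun i => ⟨sub_eq_zero.1 (h i 4), sub_eq_zero.1 (h i 5)⟩, fun i => h i 6⟩,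
      fun i => h i 3⟩, fun m => congrFun (congrFun hV m), fun i => ⟨h i 0, h i 1⟩,
      fun i => h i 2⟩

/-- the 18 DoFs (vertex values, edge normal-normal moments against
ℙ₁(e), edge tangent-normal means) are unisolvent on Σʳ(K); in particular if all
of them vanish at τ ∈ Σʳ(K) then τ = 0. -/
theorem statement9 (v : Fin 3 → V2) (hv : AffineIndependent ℝ v) :
    -- unisolvence: any prescribed 18 DoF values are attained by a unique τ ∈ Σʳ(K)
    (∀ (Aval : Fin 3 → Mat2), (∀ i, (Aval i).IsSymm) →
      ∀ (m₀ m₁ t₀ : Fin 3 → ℝ),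
      ∃! τ : V2 → Mat2, τ ∈ SigmaR v ∧
        (∀ i, τ (v i) = Aval i) ∧
        (∀ i, dofNN v i τ 1 = m₀ i ∧ dofNN v i τ Polynomial.X = m₁ i) ∧
        (∀ i, dofTN v i τ = t₀ i)) ∧
    -- in particular: vanishing of all the DoFs implies τ = 0
    (∀ τ ∈ SigmaR v,
      (∀ i, τ (v i) = 0) →
      (∀ i, ∀ P : Polynomial ℝ, P.natDegree ≤ 1 → dofNN v i τ P = 0) →
      (∀ i, dofTN v i τ = 0) →
      τ = 0) := by
  have hD := area2_ne_zero hv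
  have main : ∀ (Aval : Fin 3 → Mat2), (∀ i, (Aval i).IsSymm) →
      ∀ (m₀ m₁ t₀ : Fin 3 → ℝ),
      ∃! τ : V2 → Mat2, τ ∈ SigmaR v ∧
        (∀ i, τ (v i) = Aval i) ∧
        (∀ i, dofNN v i τ 1 = m₀ i ∧ dofNN v i τ Polynomial.X = m₁ i) ∧
        (∀ i, dofTN v i τ = t₀ i) := by
    intro A hA m₀ m₁ t₀
    obtain ⟨κ, hκ⟩ := dofMap_surjective hD (fun m i => dyadCoeff v m (A i),
      fun i => ![m₀ i, m₁ i, t₀ i, 0, 0, 0, 0])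
    refine ⟨dyadField v κ, (dofMap_eq_iff hD κ hA m₀ m₁ t₀).2 hκ, fun τ hτ => ?_⟩
    obtain ⟨κ', rfl⟩ := exists_dyadField_eq hD hτ.1.1 hτ.1.2.1
    rw [dofMap_injective hD (((dofMap_eq_iff hD κ' hA m₀ m₁ t₀).1 hτ).trans hκ.symm)]
  refine ⟨main, fun τ hτ h0 h1 h2 => ?_⟩
  obtain ⟨κ, rfl⟩ := exists_dyadField_eq hD hτ.1 hτ.2.1
  have hκ := (dofMap_eq_iff hD κ (A := 0) (fun _ => isSymm_zero) 0 0 0).1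
    ⟨hτ, h0, fun i => ⟨h1 i 1 (by simp), h1 i .X (by simp)⟩, h2⟩
  have h : dofMap v κ = 0 := by
    rw [hκ]
    refine Prod.ext ?_ ?_
    · funext m i
      simp [dyadCoeff, dot2]
    · funext i n
      fin_cases n <;> rfl
  rw [(injective_iff_map_eq_zero _).1 (dofMap_injective hD) κ h]
  funext x
  simp [dyadField, cubic]
end
end

section
/- Let d ≥ 2, let n ∈ ℝ^d be a unit vector, let s ∈ ℝ, let F := {x ∈ ℝ^d : x·n = s} (an affine hyperplane), and let Π := I − n nᵀ. Then the set of restrictions to F of the projected rigid motions, {(x ↦ Π v(x))|_F : v ∈ RM}, equals {(x ↦ c + B x)|_F : c ∈ ℝ^d with c·n = 0, B a skew-symmetric d×d real matrix with B n = 0}, which is the lowest-order Nédélec (rigid-motion) space ND₀(F) of the hyperplane F. -/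
open Matrix

/-- The orthogonal projection onto the hyperplane `n⊥` subtracts the component along `n`. -/
theorem one_sub_vecMulVec_mulVec {ι : Type*} [Fintype ι] [DecidableEq ι] (n v : ι → ℝ) :
    (1 - vecMulVec n n) *ᵥ v = v - (v ⬝ᵥ n) • n := by
  rw [sub_mulVec, one_mulVec, vecMulVec_mulVec, dotProduct_comm]
  simp

theorem transpose_one_sub_vecMulVec {ι : Type*} [DecidableEq ι] (n : ι → ℝ) :
    (1 - vecMulVec n n)ᵀ = 1 - vecMulVec n n := by
  rw [transpose_sub, transpose_one, transpose_vecMulVec]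

/-- A skew-symmetric matrix which annihilates `n` has range orthogonal to `n`. -/
theorem mulVec_dotProduct_eq_zero_of_skew {ι : Type*} [Fintype ι] {B : Matrix ι ι ℝ}
    {n : ι → ℝ} (hB : Bᵀ = -B) (hBn : B *ᵥ n = 0) (x : ι → ℝ) : (B *ᵥ x) ⬝ᵥ n = 0 := by
  rw [dotProduct_comm, dotProduct_mulVec, ← mulVec_transpose, hB, neg_mulVec, hBn, neg_zero,
    zero_dotProduct]

/-- for a unit vector n ∈ ℝ^d (d ≥ 2), s ∈ ℝ, the affine hyperplane
F = {x : x·n = s} and Π := I − n nᵀ, the set of restrictions to F of the projected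
rigid motions x ↦ Π v(x), v ∈ RM, equals the set of restrictions to F of the fields
x ↦ c + B x with c·n = 0 and B skew-symmetric with B n = 0, i.e. the lowest-order
Nédélec (rigid-motion) space ND₀(F) of the hyperplane F. -/
theorem statement11 (d : ℕ) (hd : 2 ≤ d) (n : Fin d → ℝ) (hn : ∑ i, n i * n i = 1)
    (s : ℝ) :
    {g : {x : Fin d → ℝ // ∑ i, x i * n i = s} → (Fin d → ℝ) |
      ∃ (a : Fin d → ℝ) (A : Matrix (Fin d) (Fin d) ℝ), Aᵀ = -A ∧
        ∀ x, g x = (1 - Matrix.vecMulVec n n).mulVec (a + A.mulVec x.1)} =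
    {g : {x : Fin d → ℝ // ∑ i, x i * n i = s} → (Fin d → ℝ) |
      ∃ (c : Fin d → ℝ) (B : Matrix (Fin d) (Fin d) ℝ),
        (∑ i, c i * n i) = 0 ∧ Bᵀ = -B ∧ B.mulVec n = 0 ∧
        ∀ x, g x = c + B.mulVec x.1} := by
  change n ⬝ᵥ n = 1 at hn
  ext g
  constructor
  · rintro ⟨a, A, hA, hg⟩
    set P := 1 - vecMulVec n n with hP
    have hPn : P *ᵥ n = 0 := by rw [hP, one_sub_vecMulVec_mulVec, hn, one_smul, sub_self]
    refine ⟨P *ᵥ (a + s • A *ᵥ n), P * A * P, ?_, ?_, ?_, fun x => ?_⟩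
    · change (P *ᵥ (a + s • A *ᵥ n)) ⬝ᵥ n = 0
      rw [hP, one_sub_vecMulVec_mulVec, sub_dotProduct, smul_dotProduct, hn, smul_eq_mul, mul_one,
        sub_self]
    · rw [transpose_mul, transpose_mul, hA, hP, transpose_one_sub_vecMulVec]
      simp only [Matrix.neg_mul, Matrix.mul_neg, Matrix.mul_assoc]
    · rw [← mulVec_mulVec, hPn, mulVec_zero]
    · have hx : x.1 ⬝ᵥ n = s := x.2
      have hPx : P *ᵥ x.1 = x.1 - s • n := by rw [hP, one_sub_vecMulVec_mulVec, hx]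
      rw [hg, ← mulVec_mulVec, ← mulVec_mulVec, ← mulVec_add, hPx, mulVec_sub, mulVec_smul]
      congr 1
      abel
  · rintro ⟨c, B, hc, hB, hBn, hg⟩
    change c ⬝ᵥ n = 0 at hc
    refine ⟨c, B, hB, fun x => ?_⟩
    rw [hg, one_sub_vecMulVec_mulVec, add_dotProduct, hc,
      mulVec_dotProduct_eq_zero_of_skew hB hBn, add_zero, zero_smul, sub_zero]
end
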